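/- arXiv:math/0001116 — 2 statements merged into one kernel-verified Lean document; each statement's English description precedes it below -/
import Mathlib

section
/- For q ∈ Ω and an integer k ≥ 0, let E_k(q) ⊆ (ℂ^{2n+1})* be the ℂ-linear span of the covectors (ℒ_{X_j} ⋯ ℒ_{X₁}(a·θ))(q) for 0 ≤ j ≤ k, where X₁, …, X_j range over all smooth sections (near q) of the pointwise ℂ-span of L_1̄, …, L_n̄ and a ranges over all smooth real-valued nonvanishing functions near q. Suppose ℓ ≥ 1 is an integer and V ⊆ Ω is an open set such that E_{ℓ−1}(q) = E_ℓ(q) for every q ∈ V and dim_ℂ E_{ℓ−1}(q) is constant on V. Then E_k(q) = E_{ℓ−1}(q) for every integer k ≥ ℓ and every q ∈ V. -/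
open scoped Topology

noncomputable section

/-- A complex vector field on (an open subset of) `ℝ^m`, given by its components:
it acts on functions by `(Xu)(x) = Du(x)·X(x)`. -/
abbrev VF (m : ℕ) := (Fin m → ℝ) → Fin m → ℂ

/-- A complex 1-form on `ℝ^m`, given by its components in the standard coordinates. -/
abbrev Form (m : ℕ) := (Fin m → ℝ) → Fin m → ℂ

/-- The action `(Xu)(x) = Du(x)·X(x)` of a complex vector field on a function. -/
noncomputable def vapp {m : ℕ} (X : VF m) (u : (Fin m → ℝ) → ℂ) (x : Fin m → ℝ) : ℂ :=
  ∑ i, X x i * fderiv ℝ u x (Pi.single i 1)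

/-- The Lie bracket `[X,Y](x) = DY(x)·X(x) − DX(x)·Y(x)` of complex vector fields. -/
noncomputable def vbrk {m : ℕ} (X Y : VF m) : VF m :=
  fun x j => vapp X (fun y => Y y j) x - vapp Y (fun y => X y j) x

/-- The componentwise complex conjugate `X̄` of a complex vector field. -/
def vconj {m : ℕ} (X : VF m) : VF m := fun x i => (starRingEnd ℂ) (X x i)

/-- The pairing `⟨ω,X⟩(x) = ω(x)(X(x))` of a 1-form with a vector field. -/
noncomputable def fpair {m : ℕ} (ω : Form m) (X : VF m) : (Fin m → ℝ) → ℂ :=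
  fun x => ∑ i, ω x i * X x i

/-- `⟨dω, X∧Y⟩ = X⟨ω,Y⟩ − Y⟨ω,X⟩ − ⟨ω,[X,Y]⟩`. -/
noncomputable def dpair {m : ℕ} (ω : Form m) (X Y : VF m) (x : Fin m → ℝ) : ℂ :=
  vapp X (fpair ω Y) x - vapp Y (fpair ω X) x - fpair ω (vbrk X Y) x

/-- The Lie derivative `ℒ_X ω := X ⌟ dω`, in components: its pairing with a constant
coordinate vector field is `⟨dω, X ∧ e_i⟩`. -/
noncomputable def lieD {m : ℕ} (X : VF m) (ω : Form m) : Form m :=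
  fun x i => dpair ω X (fun _ => Pi.single i 1) x

/-- Iterated Lie derivative `ℒ_{X_k} ⋯ ℒ_{X_1} ω`, for `Xs = [X₁,…,X_k]`. -/
noncomputable def iterLieD {m : ℕ} (Xs : List (VF m)) (ω : Form m) : Form m :=
  Xs.foldl (fun w X => lieD X w) ω

/-- `h_{Ā₁…Ā_k B} := ⟨ℒ_{L_{Ā_k}} ⋯ ℒ_{L_{Ā₁}} θ, L_B⟩` (for `As = [A₁,…,A_k]`). -/
noncomputable def hD {n : ℕ} (L : Fin n → VF (2 * n + 1)) (θ : Form (2 * n + 1))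
    (As : List (Fin n)) (B : Fin n) : (Fin (2 * n + 1) → ℝ) → ℂ :=
  fpair (iterLieD (As.map fun A => vconj (L A)) θ) (L B)

/-- `h_{Ā₁…Ā_k} := ⟨ℒ_{L_{Ā_k}} ⋯ ℒ_{L_{Ā₁}} θ, T⟩`. -/
noncomputable def hT {n : ℕ} (L : Fin n → VF (2 * n + 1)) (T : VF (2 * n + 1))
    (θ : Form (2 * n + 1)) (As : List (Fin n)) : (Fin (2 * n + 1) → ℝ) → ℂ :=
  fpair (iterLieD (As.map fun A => vconj (L A)) θ) T

/-- The frame and dual coframe data of Context 5/6/7/18: `T, L_A, L_Ā` is a smooth pointwise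
basis of `ℂ^{2n+1}` on `Ω`, the span of the `L_Ā` is closed under brackets (integrable CR
structure of hypersurface type), and `θ, θ^A, θ^Ā` is the dual coframe. -/
structure CRFrame (n : ℕ) (Ω : Set (Fin (2 * n + 1) → ℝ)) (T : VF (2 * n + 1))
    (L : Fin n → VF (2 * n + 1)) (θ : Form (2 * n + 1))
    (θup θbar : Fin n → Form (2 * n + 1)) : Prop where
  open_Ω : IsOpen Ω
  mem0 : (0 : Fin (2 * n + 1) → ℝ) ∈ Ω
  smoothT : ContDiffOn ℝ (⊤ : ℕ∞) T Ω
  smoothL : ∀ A, ContDiffOn ℝ (⊤ : ℕ∞) (L A) Ω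
  smoothθ : ContDiffOn ℝ (⊤ : ℕ∞) θ Ω
  smoothθup : ∀ A, ContDiffOn ℝ (⊤ : ℕ∞) (θup A) Ω
  smoothθbar : ∀ A, ContDiffOn ℝ (⊤ : ℕ∞) (θbar A) Ω
  indep : ∀ x ∈ Ω, LinearIndependent ℂ
    (Sum.elim (fun _ : Fin 1 => T x) (Sum.elim (fun A => L A x) (fun A => vconj (L A) x)))
  spans : ∀ x ∈ Ω, Submodule.span ℂ
    (Set.range (Sum.elim (fun _ : Fin 1 => T x)
      (Sum.elim (fun A => L A x) (fun A => vconj (L A) x)))) = ⊤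
  integrable : ∀ A B, ∀ x ∈ Ω, vbrk (vconj (L A)) (vconj (L B)) x ∈
    Submodule.span ℂ (Set.range fun C => vconj (L C) x)
  dual_θ_T : ∀ x ∈ Ω, fpair θ T x = 1
  dual_θ_L : ∀ A, ∀ x ∈ Ω, fpair θ (L A) x = 0
  dual_θ_Lb : ∀ A, ∀ x ∈ Ω, fpair θ (vconj (L A)) x = 0
  dual_θup_T : ∀ A, ∀ x ∈ Ω, fpair (θup A) T x = 0
  dual_θup_L : ∀ A B, ∀ x ∈ Ω, fpair (θup A) (L B) x = if A = B then 1 else 0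
  dual_θup_Lb : ∀ A B, ∀ x ∈ Ω, fpair (θup A) (vconj (L B)) x = 0
  dual_θbar_T : ∀ A, ∀ x ∈ Ω, fpair (θbar A) T x = 0
  dual_θbar_L : ∀ A B, ∀ x ∈ Ω, fpair (θbar A) (L B) x = 0
  dual_θbar_Lb : ∀ A B, ∀ x ∈ Ω, fpair (θbar A) (vconj (L B)) x = if A = B then 1 else 0

/-- The subspace `E_k(q) ⊆ (ℂ^{2n+1})*` (identified with `ℂ^{2n+1}` via components):
the span of the covectors `(ℒ_{X_j}⋯ℒ_{X₁}(a·θ))(q)`, `0 ≤ j ≤ k`, where the `X_i` range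
over smooth sections, near `q`, of the pointwise span of `L_1̄,…,L_n̄`, and `a` over smooth
real nonvanishing functions near `q` (so `a·θ` ranges over the characteristic forms). -/
noncomputable def Esp {n : ℕ} (L : Fin n → VF (2 * n + 1)) (θ : Form (2 * n + 1)) (k : ℕ)
    (q : Fin (2 * n + 1) → ℝ) : Submodule ℂ (Fin (2 * n + 1) → ℂ) :=
  Submodule.span ℂ {w : Fin (2 * n + 1) → ℂ | ∃ j ≤ k, ∃ Xs : List (VF (2 * n + 1)),
    Xs.length = j ∧
    (∀ X ∈ Xs, ∃ V : Set (Fin (2 * n + 1) → ℝ), IsOpen V ∧ q ∈ V ∧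
      ContDiffOn ℝ (⊤ : ℕ∞) X V ∧
      ∀ y ∈ V, X y ∈ Submodule.span ℂ (Set.range fun C => vconj (L C) y)) ∧
    ∃ a : (Fin (2 * n + 1) → ℝ) → ℝ,
      (∃ V : Set (Fin (2 * n + 1) → ℝ), IsOpen V ∧ q ∈ V ∧
        ContDiffOn ℝ (⊤ : ℕ∞) a V ∧ ∀ y ∈ V, a y ≠ 0) ∧
      w = iterLieD Xs (fun y i => (a y : ℂ) * θ y i) q}

/-- partial derivative `∂_j ω_i`. -/
def pdv {m : ℕ} (ω : Form m) (x : Fin m → ℝ) (j i : Fin m) : ℂ :=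
  fderiv ℝ (fun y => ω y i) x (Pi.single j 1)

theorem diffAt_comp {m : ℕ} {ω : Form m} {x : Fin m → ℝ} (h : DifferentiableAt ℝ ω x)
    (i : Fin m) : DifferentiableAt ℝ (fun y => ω y i) x :=
  differentiableAt_pi.1 h i

theorem fderiv_sum_mul {m : ℕ} {ι : Type*} [Fintype ι] (f g : ι → (Fin m → ℝ) → ℂ)
    (x v : Fin m → ℝ) (hf : ∀ i, DifferentiableAt ℝ (f i) x)
    (hg : ∀ i, DifferentiableAt ℝ (g i) x) :
    fderiv ℝ (fun y => ∑ i, f i y * g i y) x v =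
      ∑ i, (fderiv ℝ (f i) x v * g i x + f i x * fderiv ℝ (g i) x v) := by
  have h : HasFDerivAt (fun y => ∑ i, f i y * g i y)
      (∑ i, (f i x • fderiv ℝ (g i) x + g i x • fderiv ℝ (f i) x)) x :=
    HasFDerivAt.fun_sum fun i _ => (hf i).hasFDerivAt.mul (hg i).hasFDerivAt
  rw [h.fderiv]
  simp only [sum_apply, add_apply, smul_apply, smul_eq_mul]
  refine Finset.sum_congr rfl fun i _ => ?_
  ring

theorem fpair_eq {m : ℕ} (ω : Form m) (X : VF m) :
    fpair ω X = fun x => ∑ i, ω x i * X x i := rfl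

theorem lieD_eq {m : ℕ} (X : VF m) (ω : Form m) (x : Fin m → ℝ)
    (hX : DifferentiableAt ℝ X x) (hω : DifferentiableAt ℝ ω x) (i : Fin m) :
    lieD X ω x i = ∑ j, X x j * (pdv ω x j i - pdv ω x i j) := by
  have e1 : fpair ω (fun _ => Pi.single i 1) = fun y => ω y i := by
    funext y; simp [fpair, Pi.single_apply]
  have e2 : ∀ u : (Fin m → ℝ) → ℂ,
      vapp (fun _ => Pi.single i 1 : VF m) u x = fderiv ℝ u x (Pi.single i 1) := by
    intro u; simp [vapp, Pi.single_apply]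
  unfold lieD dpair
  rw [e1, e2]
  simp only [fpair_eq, vbrk, e2]
  rw [fderiv_sum_mul (fun j y => ω y j) (fun j y => X y j) x _ (diffAt_comp hω) (diffAt_comp hX)]
  simp only [vapp, fderiv_fun_const, Pi.zero_apply, zero_apply, mul_zero,
    Finset.sum_const_zero, zero_sub, mul_neg, Finset.sum_neg_distrib, sub_neg_eq_add,
    Finset.sum_add_distrib, mul_sub, Finset.sum_sub_distrib, pdv]
  have : ∑ j, fderiv ℝ (fun y => ω y j) x (Pi.single i 1) * X x j
      = ∑ j, X x j * fderiv ℝ (fun y => ω y j) x (Pi.single i 1) :=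
    Finset.sum_congr rfl fun j _ => mul_comm _ _
  rw [this]
  ring

/-- the exterior derivative as a pointwise bilinear expression -/
def dbil {m : ℕ} (ω : Form m) (x : Fin m → ℝ) (u v : Fin m → ℂ) : ℂ :=
  ∑ i, (∑ j, u j * (pdv ω x j i - pdv ω x i j)) * v i

theorem dbil_span {m : ℕ} (ω : Form m) (x : Fin m → ℝ) (v : Fin m → ℂ) (s : Set (Fin m → ℂ))
    (h : ∀ u ∈ s, dbil ω x u v = 0) (u : Fin m → ℂ) (hu : u ∈ Submodule.span ℂ s) :
    dbil ω x u v = 0 := by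
  induction hu using Submodule.span_induction with
  | mem u hu => exact h u hu
  | zero => simp [dbil]
  | add a b _ _ ha hb =>
    have : dbil ω x (a + b) v = dbil ω x a v + dbil ω x b v := by
      simp [dbil, add_mul, Finset.sum_add_distrib]
    rw [this, ha, hb, add_zero]
  | smul c a _ ha =>
    have : dbil ω x (c • a) v = c * dbil ω x a v := by
      simp only [dbil, Finset.mul_sum, Finset.sum_mul, Pi.smul_apply, smul_eq_mul]
      refine Finset.sum_congr rfl fun i _ => Finset.sum_congr rfl fun j _ => ?_
      ring
    rw [this, ha, mul_zero]

theorem fpair_span {m : ℕ} (w : Fin m → ℂ) (s : Set (Fin m → ℂ))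
    (h : ∀ u ∈ s, ∑ i, w i * u i = 0) (u : Fin m → ℂ) (hu : u ∈ Submodule.span ℂ s) :
    ∑ i, w i * u i = 0 := by
  induction hu using Submodule.span_induction with
  | mem u hu => exact h u hu
  | zero => simp
  | add a b _ _ ha hb => simp [mul_add, Finset.sum_add_distrib, ha, hb]
  | smul c a _ ha =>
    have : ∑ i, w i * (c • a) i = c * ∑ i, w i * a i := by
      simp only [Finset.mul_sum, Pi.smul_apply, smul_eq_mul]
      exact Finset.sum_congr rfl fun i _ => by ring
    rw [this, ha, mul_zero]

theorem dbil_eq {m : ℕ} (ω : Form m) (X Y : VF m) (x : Fin m → ℝ)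
    (hX : DifferentiableAt ℝ X x) (hY : DifferentiableAt ℝ Y x) (hω : DifferentiableAt ℝ ω x) :
    dbil ω x (X x) (Y x) = dpair ω X Y x := by
  unfold dpair
  simp only [vapp, fpair_eq, vbrk]
  simp_rw [fun v => fderiv_sum_mul (fun j y => ω y j) (fun j y => Y y j) x v
    (diffAt_comp hω) (diffAt_comp hY), fun v => fderiv_sum_mul (fun j y => ω y j)
    (fun j y => X y j) x v (diffAt_comp hω) (diffAt_comp hX)]
  simp only [dbil, pdv, mul_add, mul_sub, sub_mul, Finset.sum_add_distrib,
    Finset.sum_sub_distrib, Finset.mul_sum, Finset.sum_mul]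
  rw [Finset.sum_comm (f := fun i j => X x j * fderiv ℝ (fun y => ω y i) x (Pi.single j 1) * Y x i)]
  rw [Finset.sum_comm (f := fun i j => ω x i * (X x j * fderiv ℝ (fun y => Y y i) x (Pi.single j 1)))]
  rw [Finset.sum_comm (f := fun i j => ω x i * (Y x j * fderiv ℝ (fun y => X y i) x (Pi.single j 1)))]
  simp only [← Finset.sum_sub_distrib, ← Finset.sum_add_distrib]
  refine Finset.sum_congr rfl fun i _ => Finset.sum_congr rfl fun j _ => ?_
  ring

/-- smooth near `q` and annihilating the CR vector fields -/
def GoodAt {n : ℕ} (L : Fin n → VF (2 * n + 1)) (ω : Form (2 * n + 1))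
    (q : Fin (2 * n + 1) → ℝ) : Prop :=
  ∀ᶠ y in 𝓝 q, ContDiffAt ℝ (⊤ : ℕ∞) ω y ∧ ∀ A, fpair ω (vconj (L A)) y = 0

/-- section of the CR bundle near `q` -/
def SecAt {n : ℕ} (L : Fin n → VF (2 * n + 1)) (X : VF (2 * n + 1))
    (q : Fin (2 * n + 1) → ℝ) : Prop :=
  ∃ V : Set (Fin (2 * n + 1) → ℝ), IsOpen V ∧ q ∈ V ∧
      ContDiffOn ℝ (⊤ : ℕ∞) X V ∧
      ∀ y ∈ V, X y ∈ Submodule.span ℂ (Set.range fun C => vconj (L C) y)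

/-- admissible factor near `q` -/
def FacAt {m : ℕ} (a : (Fin m → ℝ) → ℝ) (q : Fin m → ℝ) : Prop :=
  ∃ V : Set (Fin m → ℝ), IsOpen V ∧ q ∈ V ∧ ContDiffOn ℝ (⊤ : ℕ∞) a V ∧ ∀ y ∈ V, a y ≠ 0

theorem SecAt.eventually {n : ℕ} {L : Fin n → VF (2 * n + 1)} {X : VF (2 * n + 1)}
    {q : Fin (2 * n + 1) → ℝ} (h : SecAt L X q) : ∀ᶠ y in 𝓝 q, SecAt L X y := by
  obtain ⟨V, hV, hq, h⟩ := h
  filter_upwards [hV.mem_nhds hq] with y hy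
  exact ⟨V, hV, hy, h⟩

theorem SecAt.contDiffAt {n : ℕ} {L : Fin n → VF (2 * n + 1)} {X : VF (2 * n + 1)}
    {q : Fin (2 * n + 1) → ℝ} (h : SecAt L X q) : ContDiffAt ℝ (⊤ : ℕ∞) X q := by
  obtain ⟨V, hV, hq, h, _⟩ := h
  exact h.contDiffAt (hV.mem_nhds hq)

theorem SecAt.mem {n : ℕ} {L : Fin n → VF (2 * n + 1)} {X : VF (2 * n + 1)}
    {q : Fin (2 * n + 1) → ℝ} (h : SecAt L X q) :
    X q ∈ Submodule.span ℂ (Set.range fun C => vconj (L C) q) := by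
  obtain ⟨V, hV, hq, _, h⟩ := h
  exact h q hq

theorem FacAt.eventually {m : ℕ} {a : (Fin m → ℝ) → ℝ} {q : Fin m → ℝ} (h : FacAt a q) :
    ∀ᶠ y in 𝓝 q, FacAt a y := by
  obtain ⟨V, hV, hq, h⟩ := h
  filter_upwards [hV.mem_nhds hq] with y hy
  exact ⟨V, hV, hy, h⟩

theorem FacAt.contDiffAt {m : ℕ} {a : (Fin m → ℝ) → ℝ} {q : Fin m → ℝ} (h : FacAt a q) :
    ContDiffAt ℝ (⊤ : ℕ∞) a q := by
  obtain ⟨V, hV, hq, h, _⟩ := h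
  exact h.contDiffAt (hV.mem_nhds hq)

theorem top_ne_zero' : ((⊤ : ℕ∞) : WithTop ℕ∞) ≠ 0 := by simp

theorem vconj_contDiffAt {m : ℕ} {X : VF m} {x : Fin m → ℝ} (h : ContDiffAt ℝ (⊤ : ℕ∞) X x) :
    ContDiffAt ℝ (⊤ : ℕ∞) (vconj X) x := by
  rw [contDiffAt_pi] at h ⊢
  intro i
  exact (Complex.conjCLE.contDiff.contDiffAt).comp x (h i)

theorem GoodAt.fpair_sec {n : ℕ} {L : Fin n → VF (2 * n + 1)} {ω : Form (2 * n + 1)}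
    {q : Fin (2 * n + 1) → ℝ} (h : GoodAt L ω q) {u : Fin (2 * n + 1) → ℂ}
    (hu : u ∈ Submodule.span ℂ (Set.range fun C => vconj (L C) q)) :
    ∑ i, ω q i * u i = 0 := by
  refine fpair_span (ω q) _ ?_ _ hu
  rintro _ ⟨A, rfl⟩
  exact h.self_of_nhds.2 A

theorem GoodAt.lieD {n : ℕ} {Ω : Set (Fin (2 * n + 1) → ℝ)}
    {T : VF (2 * n + 1)} {L : Fin n → VF (2 * n + 1)} {θ : Form (2 * n + 1)}
    {θup θbar : Fin n → Form (2 * n + 1)} (hfr : CRFrame n Ω T L θ θup θbar)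
    {ω : Form (2 * n + 1)} {X : VF (2 * n + 1)} {q : Fin (2 * n + 1) → ℝ} (hq : q ∈ Ω)
    (h : GoodAt L ω q) (hX : SecAt L X q) : GoodAt L (lieD X ω) q := by
  have hev : ∀ᶠ y in 𝓝 q, y ∈ Ω ∧ GoodAt L ω y ∧ SecAt L X y :=
    (hfr.open_Ω.eventually_mem hq).and
      ((Filter.Eventually.eventually_nhds h).and hX.eventually)
  have hform : ∀ᶠ y in 𝓝 q, _root_.lieD X ω y =
      fun i => ∑ j, X y j * (pdv ω y j i - pdv ω y i j) := by
    filter_upwards [hev] with y hy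
    funext i
    exact lieD_eq X ω y (hy.2.2.contDiffAt.differentiableAt top_ne_zero')
      (hy.2.1.self_of_nhds.1.differentiableAt top_ne_zero') i
  filter_upwards [hev, hform.eventually_nhds] with y hy hfy
  obtain ⟨hyΩ, hg, hs⟩ := hy
  have hω := hg.self_of_nhds.1
  have hωd := hω.differentiableAt top_ne_zero'
  constructor
  · refine ContDiffAt.congr_of_eventuallyEq ?_ hfy
    have hp : ∀ i j, ContDiffAt ℝ (⊤ : ℕ∞) (fun z => pdv ω z j i) y := by
      intro i j
      have h1 : ContDiffAt ℝ (⊤ : ℕ∞) (fun z => ω z i) y := contDiffAt_pi.1 hω i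
      have h2 : ContDiffAt ℝ (⊤ : ℕ∞) (fderiv ℝ (fun z => ω z i)) y :=
        h1.fderiv_right (by simp)
      exact h2.clm_apply contDiffAt_const
    rw [contDiffAt_pi]
    intro i
    refine ContDiffAt.sum fun j _ => ?_
    exact (contDiffAt_pi.1 hs.contDiffAt j).mul ((hp i j).sub (hp j i))
  · intro A
    have hLd : ∀ B, DifferentiableAt ℝ (vconj (L B)) y := fun B =>
      (vconj_contDiffAt ((hfr.smoothL B).contDiffAt
        (hfr.open_Ω.mem_nhds hyΩ))).differentiableAt top_ne_zero'
    have e : fpair (_root_.lieD X ω) (vconj (L A)) y = dbil ω y (X y) (vconj (L A) y) := by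
      unfold fpair
      rw [hfy.self_of_nhds]
      rfl
    rw [e]
    refine dbil_span ω y _ _ ?_ _ hs.mem
    rintro _ ⟨B, rfl⟩
    simp only
    rw [dbil_eq ω _ _ y (hLd B) (hLd A) hωd]
    have hz : ∀ C, fpair ω (vconj (L C)) =ᶠ[𝓝 y] fun _ => 0 := fun C => by
      filter_upwards [hg] with z hz using hz.2 C
    have hv : ∀ (Z : VF (2 * n + 1)) C, vapp Z (fpair ω (vconj (L C))) y = 0 := by
      intro Z C
      unfold vapp
      rw [(hz C).fderiv_eq]
      simp
    unfold dpair
    rw [hv, hv]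
    have := hg.fpair_sec (hfr.integrable B A y hyΩ)
    simp [fpair, this]

theorem good_iter {n : ℕ} {Ω : Set (Fin (2 * n + 1) → ℝ)}
    {T : VF (2 * n + 1)} {L : Fin n → VF (2 * n + 1)} {θ : Form (2 * n + 1)}
    {θup θbar : Fin n → Form (2 * n + 1)} (hfr : CRFrame n Ω T L θ θup θbar)
    {q : Fin (2 * n + 1) → ℝ} (hq : q ∈ Ω) (Xs : List (VF (2 * n + 1))) :
    ∀ (ω : Form (2 * n + 1)), GoodAt L ω q → (∀ X ∈ Xs, SecAt L X q) →
      GoodAt L (iterLieD Xs ω) q := by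
  induction Xs with
  | nil => intro ω h _; exact h
  | cons X Xs ih =>
    intro ω h hX
    exact ih (lieD X ω) (h.lieD hfr hq (hX X (by simp))) fun Y hY => hX Y (by simp [hY])

theorem good_char {n : ℕ} {Ω : Set (Fin (2 * n + 1) → ℝ)}
    {T : VF (2 * n + 1)} {L : Fin n → VF (2 * n + 1)} {θ : Form (2 * n + 1)}
    {θup θbar : Fin n → Form (2 * n + 1)} (hfr : CRFrame n Ω T L θ θup θbar)
    {q : Fin (2 * n + 1) → ℝ} (hq : q ∈ Ω) {a : (Fin (2 * n + 1) → ℝ) → ℝ} (ha : FacAt a q) :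
    GoodAt L (fun y i => (a y : ℂ) * θ y i) q := by
  filter_upwards [hfr.open_Ω.mem_nhds hq, ha.eventually] with y hy hay
  constructor
  · rw [contDiffAt_pi]
    intro i
    refine ContDiffAt.mul ?_ ?_
    · exact Complex.ofRealCLM.contDiff.contDiffAt.comp y hay.contDiffAt
    · exact contDiffAt_pi.1 (hfr.smoothθ.contDiffAt (hfr.open_Ω.mem_nhds hy)) i
  · intro A
    have := hfr.dual_θ_Lb A y hy
    simp only [fpair] at this ⊢
    simp only [mul_assoc, ← Finset.mul_sum, this, mul_zero]

/-- `ω` is an iterated derivative of order at most `k` of a characteristic form near `q` -/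
def GenAt {n : ℕ} (L : Fin n → VF (2 * n + 1)) (θ : Form (2 * n + 1)) (k : ℕ)
    (q : Fin (2 * n + 1) → ℝ) (ω : Form (2 * n + 1)) : Prop :=
  ∃ Xs : List (VF (2 * n + 1)), Xs.length ≤ k ∧ (∀ X ∈ Xs, SecAt L X q) ∧
    ∃ a : (Fin (2 * n + 1) → ℝ) → ℝ, FacAt a q ∧ ω = iterLieD Xs (fun y i => (a y : ℂ) * θ y i)

theorem Esp_eq {n : ℕ} (L : Fin n → VF (2 * n + 1)) (θ : Form (2 * n + 1)) (k : ℕ)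
    (q : Fin (2 * n + 1) → ℝ) :
    Esp L θ k q = Submodule.span ℂ {w | ∃ ω, GenAt L θ k q ω ∧ w = ω q} := by
  unfold Esp
  congr 1
  ext w
  constructor
  · rintro ⟨j, hj, Xs, hXs, hs, a, ha, rfl⟩
    exact ⟨_, ⟨Xs, hXs ▸ hj, hs, a, ha, rfl⟩, rfl⟩
  · rintro ⟨ω, ⟨Xs, hXs, hs, a, ha, rfl⟩, rfl⟩
    exact ⟨_, hXs, Xs, rfl, hs, a, ha, rfl⟩

theorem GenAt.mem {n : ℕ} {L : Fin n → VF (2 * n + 1)} {θ : Form (2 * n + 1)} {k : ℕ}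
    {q : Fin (2 * n + 1) → ℝ} {ω : Form (2 * n + 1)} (h : GenAt L θ k q ω) :
    ω q ∈ Esp L θ k q := by
  rw [Esp_eq]
  exact Submodule.subset_span ⟨ω, h, rfl⟩

theorem GenAt.eventually {n : ℕ} {L : Fin n → VF (2 * n + 1)} {θ : Form (2 * n + 1)} {k : ℕ}
    {q : Fin (2 * n + 1) → ℝ} {ω : Form (2 * n + 1)} (h : GenAt L θ k q ω) :
    ∀ᶠ y in 𝓝 q, GenAt L θ k y ω := by
  obtain ⟨Xs, hl, hs, a, ha, rfl⟩ := h
  have : ∀ᶠ y in 𝓝 q, ∀ X ∈ Xs, SecAt L X y := by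
    clear hl
    induction Xs with
    | nil => simp
    | cons X Xs ih =>
      filter_upwards [ih fun Y hY => hs Y (by simp [hY]), (hs X (by simp)).eventually]
        with y h1 h2
      intro Y hY
      rcases List.mem_cons.1 hY with rfl | hY
      · exact h2
      · exact h1 Y hY
  filter_upwards [this, ha.eventually] with y h1 h2
  exact ⟨Xs, hl, h1, a, h2, rfl⟩

theorem GenAt.mono {n : ℕ} {L : Fin n → VF (2 * n + 1)} {θ : Form (2 * n + 1)} {k k' : ℕ}
    (hk : k ≤ k') {q : Fin (2 * n + 1) → ℝ} {ω : Form (2 * n + 1)} (h : GenAt L θ k q ω) :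
    GenAt L θ k' q ω := by
  obtain ⟨Xs, hl, h⟩ := h
  exact ⟨Xs, hl.trans hk, h⟩

theorem GenAt.lieD {n : ℕ} {L : Fin n → VF (2 * n + 1)} {θ : Form (2 * n + 1)} {k : ℕ}
    {q : Fin (2 * n + 1) → ℝ} {ω : Form (2 * n + 1)} {X : VF (2 * n + 1)}
    (h : GenAt L θ k q ω) (hX : SecAt L X q) : GenAt L θ (k + 1) q (lieD X ω) := by
  obtain ⟨Xs, hl, hs, a, ha, rfl⟩ := h
  refine ⟨Xs ++ [X], by simpa using hl, ?_, a, ha, ?_⟩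
  · intro Y hY
    rcases List.mem_append.1 hY with hY | hY
    · exact hs Y hY
    · rw [List.mem_singleton.1 hY]; exact hX
  · simp [iterLieD, List.foldl_append]

theorem GenAt.cases_succ {n : ℕ} {L : Fin n → VF (2 * n + 1)} {θ : Form (2 * n + 1)} {k : ℕ}
    {q : Fin (2 * n + 1) → ℝ} {ω : Form (2 * n + 1)} (h : GenAt L θ (k + 1) q ω) :
    GenAt L θ k q ω ∨ ∃ X η, SecAt L X q ∧ GenAt L θ k q η ∧ ω = _root_.lieD X η := by
  obtain ⟨Xs, hl, hs, a, ha, rfl⟩ := h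
  rcases List.eq_nil_or_concat Xs with rfl | ⟨Ys, X, rfl⟩
  · exact Or.inl ⟨[], by simp, hs, a, ha, rfl⟩
  · right
    simp only [List.concat_eq_append] at hs hl ⊢
    refine ⟨X, iterLieD Ys (fun y i => (a y : ℂ) * θ y i), hs X (by simp),
      ⟨Ys, by simpa using hl, fun Y hY => hs Y (by simp [hY]), a, ha, rfl⟩, ?_⟩
    simp [iterLieD, List.foldl_append]

theorem GenAt.good {n : ℕ} {Ω : Set (Fin (2 * n + 1) → ℝ)}
    {T : VF (2 * n + 1)} {L : Fin n → VF (2 * n + 1)} {θ : Form (2 * n + 1)}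
    {θup θbar : Fin n → Form (2 * n + 1)} (hfr : CRFrame n Ω T L θ θup θbar)
    {q : Fin (2 * n + 1) → ℝ} (hq : q ∈ Ω) {k : ℕ} {ω : Form (2 * n + 1)}
    (h : GenAt L θ k q ω) : GoodAt L ω q := by
  obtain ⟨Xs, hl, hs, a, ha, rfl⟩ := h
  exact good_iter hfr hq Xs _ (good_char hfr hq ha) hs

theorem det_diffAt {m : ℕ} {ι : Type*} [Fintype ι] [DecidableEq ι]
    (M : (Fin m → ℝ) → Matrix ι ι ℂ) (q : Fin m → ℝ)
    (h : ∀ i j, DifferentiableAt ℝ (fun y => M y i j) q) :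
    DifferentiableAt ℝ (fun y => (M y).det) q := by
  simp only [Matrix.det_apply]
  refine DifferentiableAt.fun_sum fun σ _ => ?_
  refine DifferentiableAt.const_smul ?_ _
  exact (HasFDerivAt.finsetProd (u := Finset.univ) (g := fun i y => M y (σ i) i)
    fun i _ => (h (σ i) i).hasFDerivAt).differentiableAt

/-- smooth local coefficients with respect to a local frame -/
theorem exists_coeff {m : ℕ} {ι : Type*} [Fintype ι] (E : (Fin m → ℝ) → Submodule ℂ (Fin m → ℂ))
    (q : Fin m → ℝ) (f : ι → Form m) (η : Form m)
    (hli : LinearIndependent ℂ fun i => f i q)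
    (hf : ∀ i, DifferentiableAt ℝ (f i) q) (hη : DifferentiableAt ℝ η q)
    (hfE : ∀ i, ∀ᶠ y in 𝓝 q, f i y ∈ E y) (hηE : ∀ᶠ y in 𝓝 q, η y ∈ E y)
    (hd : ∀ᶠ y in 𝓝 q, Module.finrank ℂ (E y) = Fintype.card ι) :
    ∃ c : ι → (Fin m → ℝ) → ℂ, (∀ i, DifferentiableAt ℝ (c i) q) ∧
      ∀ᶠ y in 𝓝 q, η y = ∑ i, c i y • f i y := by
  classical
  obtain ⟨P, hP⟩ : ∃ P : (Fin m → ℂ) →ₗ[ℂ] (ι → ℂ), ∀ i, P (f i q) = Pi.single i 1 := by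
    have hinj : LinearMap.ker (Fintype.linearCombination ℂ (fun i => f i q)) = ⊥ :=
      LinearMap.ker_eq_bot.2 hli.fintypeLinearCombination_injective
    obtain ⟨P, hP⟩ := LinearMap.exists_leftInverse_of_injective _ hinj
    refine ⟨P, fun i => ?_⟩
    have := LinearMap.congr_fun hP (Pi.single i 1)
    simpa using this
  have hPd : ∀ (ω : Form m), DifferentiableAt ℝ ω q → ∀ i,
      DifferentiableAt ℝ (fun y => P (ω y) i) q := by
    intro ω hω i
    have h1 : DifferentiableAt ℝ (fun y => (LinearMap.toContinuousLinearMap P).restrictScalars ℝ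
        (ω y)) q := ContinuousLinearMap.differentiableAt _ |>.comp q hω
    exact differentiableAt_pi.1 h1 i
  let M : (Fin m → ℝ) → Matrix ι ι ℂ := fun y => Matrix.of fun i j => P (f j y) i
  have hMd : ∀ i j, DifferentiableAt ℝ (fun y => M y i j) q := fun i j => hPd _ (hf j) i
  have hM : DifferentiableAt ℝ (fun y => (M y).det) q := det_diffAt M q hMd
  have hMq : (M q).det = 1 := by
    have : M q = 1 := by
      ext i j
      simp [M, hP, Matrix.one_apply, Pi.single_apply]
    rw [this, Matrix.det_one]
  have hne : ∀ᶠ y in 𝓝 q, (M y).det ≠ 0 :=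
    hM.continuousAt.eventually_ne (by rw [hMq]; exact one_ne_zero)
  have hMv : ∀ y (g : ι → ℂ), P (∑ i, g i • f i y) = (M y).mulVec g := by
    intro y g
    ext i
    simp [M, Matrix.mulVec, dotProduct, mul_comm]
  refine ⟨fun i y => ((M y).det)⁻¹ * ((M y).updateCol i (P (η y))).det, ?_, ?_⟩
  · intro i
    refine (hM.inv (by rw [hMq]; exact one_ne_zero)).mul (det_diffAt _ q fun a b => ?_)
    by_cases hb : b = i
    · subst hb
      simpa using hPd η hη a
    · simpa [Matrix.updateCol_ne hb] using hMd a b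
  · filter_upwards [hne, Filter.eventually_all.2 hfE, hηE, hd] with y h1 h2 h3 h4
    have hind : LinearIndependent ℂ fun i => f i y := by
      rw [Fintype.linearIndependent_iff]
      intro g hg
      have h5 := hMv y g
      rw [hg, map_zero] at h5
      have := Matrix.eq_zero_of_mulVec_eq_zero h1 h5.symm
      exact fun i => congrFun this i
    have hspan : Submodule.span ℂ (Set.range fun i => f i y) = E y := by
      refine Submodule.eq_of_le_of_finrank_eq (Submodule.span_le.2 ?_) ?_
      · rintro _ ⟨i, rfl⟩; exact h2 i
      · rw [finrank_span_eq_card hind, h4]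
    rw [← hspan, Submodule.mem_span_range_iff_exists_fun] at h3
    obtain ⟨g, hg⟩ := h3
    rw [← hg]
    refine Finset.sum_congr rfl fun i _ => ?_
    congr 1
    rw [hMv, ← Matrix.cramer_apply, Matrix.cramer_eq_adjugate_mulVec, Matrix.mulVec_mulVec,
      Matrix.adjugate_mul, Matrix.smul_mulVec, Matrix.one_mulVec]
    simp [h1]

/-- Leibniz rule for combinations of forms annihilating `X`. -/
theorem lieD_comb {m : ℕ} {ι : Type*} [Fintype ι] (X : VF m) (q : Fin m → ℝ) (f : ι → Form m)
    (c : ι → (Fin m → ℝ) → ℂ) (η : Form m) (hX : DifferentiableAt ℝ X q)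
    (hf : ∀ i, DifferentiableAt ℝ (f i) q) (hc : ∀ i, DifferentiableAt ℝ (c i) q)
    (hη : DifferentiableAt ℝ η q)
    (h : ∀ᶠ y in 𝓝 q, η y = ∑ i, c i y • f i y) (h0 : ∀ i, ∑ j, f i q j * X q j = 0) :
    lieD X η q = ∑ i, (c i q • lieD X (f i) q + vapp X (c i) q • f i q) := by
  have hp : ∀ j k, pdv η q j k = ∑ i, (fderiv ℝ (c i) q (Pi.single j 1) * f i q k +
      c i q * pdv (f i) q j k) := by
    intro j k
    unfold pdv
    have : (fun y => η y k) =ᶠ[𝓝 q] fun y => ∑ i, c i y * f i y k := by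
      filter_upwards [h] with y hy
      rw [hy]; simp
    rw [this.fderiv_eq, fderiv_sum_mul c (fun i y => f i y k) q _ hc fun i => diffAt_comp (hf i) k]
  funext k
  rw [lieD_eq X η q hX hη, Finset.sum_apply]
  simp only [Pi.add_apply, Pi.smul_apply, smul_eq_mul, lieD_eq X _ q hX (hf _), hp, vapp]
  have h1 : ∀ i, ∑ j, X q j * (fderiv ℝ (c i) q (Pi.single k 1) * f i q j) = 0 := by
    intro i
    have : ∑ j, X q j * (fderiv ℝ (c i) q (Pi.single k 1) * f i q j) =
        fderiv ℝ (c i) q (Pi.single k 1) * ∑ j, f i q j * X q j := by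
      rw [Finset.mul_sum]
      exact Finset.sum_congr rfl fun j _ => by ring
    rw [this, h0, mul_zero]
  simp only [← Finset.sum_sub_distrib, Finset.mul_sum]
  rw [Finset.sum_comm]
  refine Finset.sum_congr rfl fun i _ => ?_
  rw [Finset.sum_mul, ← Finset.sum_add_distrib, ← sub_eq_zero, ← Finset.sum_sub_distrib,
    ← neg_eq_zero, ← Finset.sum_neg_distrib, ← h1 i]
  exact Finset.sum_congr rfl fun j _ => by ring

/-- If `E_{ℓ−1}(q) = E_ℓ(q)` for every `q` in an open set `V ⊆ Ω` and
`dim_ℂ E_{ℓ−1}(q)` is constant on `V`, then `E_k(q) = E_{ℓ−1}(q)` for all `k ≥ ℓ`, `q ∈ V`. -/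
theorem statement18 (n : ℕ) (hn : 1 ≤ n) (Ω : Set (Fin (2 * n + 1) → ℝ))
    (T : VF (2 * n + 1)) (L : Fin n → VF (2 * n + 1)) (θ : Form (2 * n + 1))
    (θup θbar : Fin n → Form (2 * n + 1))
    (hfr : CRFrame n Ω T L θ θup θbar)
    (ℓ : ℕ) (hℓ : 1 ≤ ℓ) (V : Set (Fin (2 * n + 1) → ℝ)) (hV : IsOpen V) (hVΩ : V ⊆ Ω)
    (hstab : ∀ q ∈ V, Esp L θ (ℓ - 1) q = Esp L θ ℓ q)
    (hconst : ∃ d : ℕ, ∀ q ∈ V, Module.finrank ℂ ↥(Esp L θ (ℓ - 1) q) = d) :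
    ∀ k : ℕ, ℓ ≤ k → ∀ q ∈ V, Esp L θ k q = Esp L θ (ℓ - 1) q := by
  obtain ⟨d, hd⟩ := hconst
  intro k hk
  induction k, hk using Nat.le_induction with
  | base => intro q hq; exact (hstab q hq).symm
  | succ k hk ih =>
    intro q hq
    apply le_antisymm
    · rw [Esp_eq L θ (k + 1) q, Submodule.span_le]
      rintro _ ⟨ω, hω, rfl⟩
      rcases hω.cases_succ with hω | ⟨X, η, hX, hη, rfl⟩
      · rw [← ih q hq]; exact hω.mem
      · have hqΩ := hVΩ hq
        have hVn : ∀ᶠ y in 𝓝 q, y ∈ V := hV.mem_nhds hq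
        obtain ⟨b, hbS, hbspan, hbli⟩ := exists_linearIndependent ℂ
          {w | ∃ ω, GenAt L θ (ℓ - 1) q ω ∧ w = ω q}
        have : Fintype b := hbli.setFinite.fintype
        have hch : ∀ w : b, ∃ ω, GenAt L θ (ℓ - 1) q ω ∧ (w : Fin (2 * n + 1) → ℂ) = ω q :=
          fun w => hbS w.2
        choose f hfg hfq using hch
        have hli : LinearIndependent ℂ fun w : b => f w q := by
          have e : (fun w : b => f w q) = Subtype.val := by
            funext w
            exact (hfq w).symm
          rw [e]
          exact hbli
        have hcard : d = Fintype.card b := by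
          rw [← hd q hq, Esp_eq, ← hbspan, ← finrank_span_eq_card hbli, Subtype.range_coe]
        have hfd : ∀ w, DifferentiableAt ℝ (f w) q := fun w =>
          ((hfg w).good hfr hqΩ).self_of_nhds.1.differentiableAt top_ne_zero'
        have hηd := (hη.good hfr hqΩ).self_of_nhds.1.differentiableAt top_ne_zero'
        obtain ⟨c, hc, hcomb⟩ := exists_coeff (fun y => Esp L θ (ℓ - 1) y) q f η hli hfd hηd
          (fun w => by filter_upwards [(hfg w).eventually] with y hy using hy.mem)
          (by filter_upwards [hη.eventually, hVn] with y hy hyV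
              rw [← ih y hyV]; exact hy.mem)
          (by filter_upwards [hVn] with y hyV
              rw [hd y hyV, hcard])
        rw [lieD_comb X q f c η (hX.contDiffAt.differentiableAt top_ne_zero') hfd hc hηd hcomb
          (fun w => ((hfg w).good hfr hqΩ).fpair_sec hX.mem)]
        refine Submodule.sum_mem _ fun w _ => Submodule.add_mem _
          (Submodule.smul_mem _ _ ?_) (Submodule.smul_mem _ _ (hfg w).mem)
        rw [hstab q hq]
        have := ((hfg w).lieD hX).mem
        rwa [Nat.sub_add_cancel hℓ] at this
    · rw [Esp_eq L θ (ℓ - 1) q, Submodule.span_le]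
      rintro _ ⟨ω, hω, rfl⟩
      exact (hω.mono (by omega)).mem
end
end

section
/- Let q, m, k be positive integers, let d(q, k) := #{β ∈ ℤ₊^q : |β| ≤ k}, and identify the space J^k(ℝ^q, ℝ^m)₀ of k-jets at 0 of smooth maps ℝ^q → ℝ^m with ℝ^{m·d(q,k)} via the coordinates λ = (λ^β_i)_{|β| ≤ k, 1 ≤ i ≤ m}, the k-jet of f being j^k₀(f) := (∂^β_x f_i(0)). Let U ⊆ J^k(ℝ^q, ℝ^m)₀ × ℝ^q be open and, for each multi-index α ∈ ℤ₊^q with |α| = k + 1 and each j = 1, …, m, let r^α_j : U → ℝ be a smooth function, written r^α_j(λ)(x). Then for every λ₀ ∈ J^k(ℝ^q, ℝ^m)₀ with (λ₀, 0) ∈ U there exist open neighborhoods U₀ of λ₀ in J^k(ℝ^q, ℝ^m)₀ and V₀ of 0 in ℝ^q and a smooth function F : U₀ × V₀ → ℝ^m with the following property: whenever f = (f₁, …, f_m) is a smooth ℝ^m-valued map on a neighborhood of 0 in ℝ^q satisfying the complete system ∂^α_x f_j(x) = r^α_j((∂^β_x f_i(x))_{|β| ≤ k})(x) for all |α| = k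 + 1 and j = 1, …, m at every x near 0 (the argument lying in U), and j^k₀(f) ∈ U₀, then f(x) = F(j^k₀(f), x) for all x in some neighborhood of 0. -/
open scoped Topology

/-- The partial derivative `∂/∂x_i` of a function `ℝ^q → ℝ`. -/
noncomputable def pd (q : ℕ) (i : Fin q) (u : (Fin q → ℝ) → ℝ) : (Fin q → ℝ) → ℝ :=
  fun x => fderiv ℝ u x (Pi.single i 1)

/-- The partial derivative `∂^β` of order a multi-index `β ∈ ℤ₊^q`. -/
noncomputable def pdm (q : ℕ) (β : Fin q → ℕ) (u : (Fin q → ℝ) → ℝ) : (Fin q → ℝ) → ℝ :=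
  ((List.finRange q).foldr (fun i F => (pd q i)^[β i] ∘ F) id) u

noncomputable instance jetFintype (q k : ℕ) : Fintype {β : Fin q → ℕ // ∑ i, β i ≤ k} :=
  Fintype.ofInjective
    (fun (β : {β : Fin q → ℕ // ∑ i, β i ≤ k}) (i : Fin q) =>
      (⟨β.1 i, Nat.lt_succ_of_le
        ((Finset.single_le_sum (fun j _ => Nat.zero_le (β.1 j)) (Finset.mem_univ i)).trans
          β.2)⟩ : Fin (k + 1)))
    (by
      intro β β' h
      apply Subtype.ext
      funext i
      exact congrArg Fin.val (congrFun h i))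

/-- The space `J^k(ℝ^q, ℝ^m)₀` of `k`-jets at `0` of smooth maps `ℝ^q → ℝ^m`, in the natural
coordinates `λ = (λ^β_i)_{|β| ≤ k, 1 ≤ i ≤ m}`. -/
abbrev JetSp (q m k : ℕ) := {β : Fin q → ℕ // ∑ i, β i ≤ k} → Fin m → ℝ

/-- The `k`-jet of `f` at a point `x₀`, `(∂^β_x f_i(x₀))_{|β| ≤ k}`. -/
noncomputable def jetAt (q m k : ℕ) (f : (Fin q → ℝ) → Fin m → ℝ) (x₀ : Fin q → ℝ) :
    JetSp q m k :=
  fun β i => pdm q β.1 (fun y => f y i) x₀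

open Set

set_option linter.unusedSectionVars false

section Aux
variable {E F : Type} [NormedAddCommGroup E] [NormedSpace ℝ E] [NormedAddCommGroup F]
  [NormedSpace ℝ F]

/-- superposition operator -/
noncomputable def nem (g : E → F) (hg : Continuous g) (u : C(Icc (0:ℝ) 1, E)) :
    C(Icc (0:ℝ) 1, F) := ⟨fun t => g (u t), hg.comp u.continuous⟩

noncomputable def mulop1 (a : C(Icc (0:ℝ) 1, E →L[ℝ] F)) :
    C(Icc (0:ℝ) 1, E) →L[ℝ] C(Icc (0:ℝ) 1, F) :=
  LinearMap.mkContinuous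
    { toFun := fun v => ⟨fun t => a t (v t), a.continuous.clm_apply v.continuous⟩
      map_add' := by intro u v; ext t; simp
      map_smul' := by intro c v; ext t; simp } ‖a‖
    (by
      intro v
      rw [ContinuousMap.norm_le _ (by positivity)]
      intro t
      exact (a t).le_of_opNorm_le_of_le (a.norm_coe_le_norm t) (v.norm_coe_le_norm t))

@[simp] lemma mulop1_apply (a : C(Icc (0:ℝ) 1, E →L[ℝ] F)) (v : C(Icc (0:ℝ) 1, E))
    (t : Icc (0:ℝ) 1) : mulop1 a v t = a t (v t) := rfl

lemma mulop1_bdd : IsBoundedLinearMap ℝ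
    (fun a : C(Icc (0:ℝ) 1, E →L[ℝ] F) => mulop1 a) := by
  refine IsLinearMap.with_bound ⟨?_, ?_⟩ 1 ?_
  · intro u v; refine ContinuousLinearMap.ext fun w => ContinuousMap.ext fun t => ?_; simp
  · intro c v; refine ContinuousLinearMap.ext fun w => ContinuousMap.ext fun t => ?_; simp
  · intro a
    rw [one_mul]
    exact ContinuousLinearMap.opNorm_le_bound (mulop1 a) (norm_nonneg a) fun v => by
      rw [ContinuousMap.norm_le _ (by positivity)]
      intro t
      exact (a t).le_of_opNorm_le_of_le (a.norm_coe_le_norm t) (v.norm_coe_le_norm t)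

lemma mulop1_contDiff (n : WithTop ℕ∞) : ContDiff ℝ n
    (fun a : C(Icc (0:ℝ) 1, E →L[ℝ] F) => mulop1 a) :=
  IsBoundedLinearMap.contDiff (𝕜 := ℝ) (E := C(Icc (0:ℝ) 1, E →L[ℝ] F))
    (F := C(Icc (0:ℝ) 1, E) →L[ℝ] C(Icc (0:ℝ) 1, F)) mulop1_bdd

lemma nem_continuous (g : E → F) (hg : Continuous g) : Continuous (nem g hg) :=
  ContinuousMap.continuous_postcomp ⟨g, hg⟩

lemma nem_hasFDerivAt (g : E → F) (hg : ContDiff ℝ 1 g) (u : C(Icc (0:ℝ) 1, E)) :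
    HasFDerivAt (nem g hg.continuous)
      (mulop1 (nem (fderiv ℝ g) (hg.continuous_fderiv one_ne_zero) u)) u := by
  have hc := hg.continuous_fderiv one_ne_zero
  rw [hasFDerivAt_iff_isLittleO, Asymptotics.isLittleO_iff]
  intro ε hε
  have h1 := Metric.continuous_iff.1 (nem_continuous _ hc) u ε hε
  obtain ⟨δ, hδ, h⟩ := h1
  filter_upwards [Metric.ball_mem_nhds u hδ] with v hv
  rw [ContinuousMap.norm_le _ (by positivity)]
  intro t
  have hb : ∀ x ∈ segment ℝ (u t) (v t), ‖fderiv ℝ g x - fderiv ℝ g (u t)‖ ≤ ε := by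
    intro x hx
    rw [segment_eq_image'] at hx
    obtain ⟨θ, hθ, rfl⟩ := hx
    have := h (u + θ • (v - u)) (by
      rw [dist_eq_norm, add_sub_cancel_left, norm_smul, Real.norm_of_nonneg hθ.1]
      rw [Metric.mem_ball, dist_eq_norm] at hv
      exact (mul_le_of_le_one_left (norm_nonneg _) hθ.2).trans_lt hv)
    have h2 := (ContinuousMap.dist_le_iff_of_nonempty).1 this.le t
    rw [dist_eq_norm] at h2
    exact h2
  have := (convex_segment (𝕜 := ℝ) (u t) (v t)).norm_image_sub_le_of_norm_hasFDerivWithin_le'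
    (f := g) (f' := fderiv ℝ g) (φ := fderiv ℝ g (u t)) (C := ε)
    (fun x _ => ((hg.differentiable one_ne_zero) x).hasFDerivAt.hasFDerivWithinAt) hb
    (left_mem_segment _ _ _) (right_mem_segment _ _ _)
  refine this.trans ?_
  exact mul_le_mul_of_nonneg_left ((v - u).norm_coe_le_norm t) hε.le
end Aux

lemma nem_contDiff_nat (n : ℕ) : ∀ {E F : Type} [NormedAddCommGroup E] [NormedSpace ℝ E]
    [NormedAddCommGroup F] [NormedSpace ℝ F] (g : E → F) (hg : ContDiff ℝ (⊤ : ℕ∞) g),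
    ContDiff ℝ n (nem g hg.continuous) := by
  induction n with
  | zero =>
    intro E F _ _ _ _ g hg
    exact contDiff_zero.2 (nem_continuous g hg.continuous)
  | succ n ih =>
    intro E F _ _ _ _ g hg
    have h1 : ContDiff ℝ 1 g := hg.of_le (by exact_mod_cast le_top)
    have h2 : ContDiff ℝ (⊤ : ℕ∞) (fderiv ℝ g) := hg.fderiv_right (by simp)
    push_cast
    rw [contDiff_succ_iff_hasFDerivAt]
    exact ⟨fun u => mulop1 (nem (fderiv ℝ g) h2.continuous u),
      (mulop1_contDiff n).comp (ih _ h2), fun u => nem_hasFDerivAt g h1 u⟩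

lemma nem_contDiff {E F : Type} [NormedAddCommGroup E] [NormedSpace ℝ E]
    [NormedAddCommGroup F] [NormedSpace ℝ F] (g : E → F) (hg : ContDiff ℝ (⊤ : ℕ∞) g) :
    ContDiff ℝ (⊤ : ℕ∞) (nem g hg.continuous) :=
  contDiff_infty.2 fun n => nem_contDiff_nat n g hg

/-- integration operator -/
noncomputable def intop {E : Type} [NormedAddCommGroup E] [NormedSpace ℝ E] :
    C(Icc (0:ℝ) 1, E) →L[ℝ] C(Icc (0:ℝ) 1, E) :=
  LinearMap.mkContinuous
    { toFun := fun v => ⟨fun t => ∫ s in (0:ℝ)..t, v (projIcc 0 1 zero_le_one s), by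
        have : Continuous fun s : ℝ => v (projIcc 0 1 zero_le_one s) :=
          v.continuous.comp continuous_projIcc
        exact (intervalIntegral.continuous_primitive
          (fun a b => this.intervalIntegrable a b) 0).comp continuous_subtype_val⟩
      map_add' := by
        intro u v; ext t
        have hu : Continuous fun s : ℝ => u (projIcc 0 1 zero_le_one s) :=
          u.continuous.comp continuous_projIcc
        have hv : Continuous fun s : ℝ => v (projIcc 0 1 zero_le_one s) :=
          v.continuous.comp continuous_projIcc
        simp [intervalIntegral.integral_add (hu.intervalIntegrable _ _)
          (hv.intervalIntegrable _ _)]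
      map_smul' := by intro c v; ext t; simp } 1
    (by
      intro v
      rw [ContinuousMap.norm_le _ (by positivity)]
      intro t
      have := intervalIntegral.norm_integral_le_of_norm_le_const (a := 0) (b := (t:ℝ))
        (f := fun s => v (projIcc 0 1 zero_le_one s)) (C := ‖v‖)
        (fun s _ => v.norm_coe_le_norm _)
      refine this.trans ?_
      rw [sub_zero, abs_of_nonneg t.2.1, one_mul]
      exact mul_le_of_le_one_right (norm_nonneg _) t.2.2)

lemma intop_apply {E : Type} [NormedAddCommGroup E] [NormedSpace ℝ E]
    (v : C(Icc (0:ℝ) 1, E)) (t : Icc (0:ℝ) 1) :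
    intop v t = ∫ s in (0:ℝ)..t, v (projIcc 0 1 zero_le_one s) := rfl

lemma implicit_aux {P B : Type} [NormedAddCommGroup P] [NormedSpace ℝ P] [CompleteSpace P]
    [NormedAddCommGroup B] [NormedSpace ℝ B] [CompleteSpace B]
    (S : P × B → B) (hS : ContDiff ℝ (⊤ : ℕ∞) S) (p0 : P) (u0 : B)
    (h0 : ∀ u, S (p0, u) = u0) :
    ∃ (O : Set P) (O' : Set (P × B)) (G : P → B), IsOpen O ∧ p0 ∈ O ∧ IsOpen O' ∧
      (p0, u0) ∈ O' ∧ ContDiffOn ℝ (⊤ : ℕ∞) G O ∧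
      ∀ p u, (p, u) ∈ O' → u = S (p, u) → u = G p := by
  have htop : ((⊤ : ℕ∞) : WithTop ℕ∞) ≠ 0 := by simp
  let T : P × B → P × B := fun z => (z.1, z.2 - S z)
  have hT : ContDiff ℝ (⊤ : ℕ∞) T := contDiff_fst.prodMk (contDiff_snd.sub hS)
  let L := fderiv ℝ S (p0, u0)
  have hL : HasFDerivAt S L (p0, u0) := (hS.differentiable htop _).hasFDerivAt
  have hL0 : ∀ v, L (0, v) = 0 := by
    intro v
    have h1 : HasFDerivAt (fun u => S (p0, u)) (L.comp (ContinuousLinearMap.inr ℝ P B)) u0 :=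
      hL.comp u0 (hasFDerivAt_prodMk_right p0 u0)
    have h2 : HasFDerivAt (fun u => S (p0, u)) (0 : B →L[ℝ] B) u0 := by
      simp only [h0]; exact hasFDerivAt_const _ _
    have := congrArg (fun A : B →L[ℝ] B => A v) (h1.unique h2)
    simpa using this
  have hLe : ∀ a v, L (a, v) = L (a, 0) := by
    intro a v
    have : (a, v) = (a, 0) + ((0 : P), v) := by simp
    rw [this, map_add, hL0, add_zero]
  let A : (P × B) →L[ℝ] (P × B) :=
    (ContinuousLinearMap.fst ℝ P B).prod (ContinuousLinearMap.snd ℝ P B - L)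
  let A' : (P × B) →L[ℝ] (P × B) :=
    (ContinuousLinearMap.fst ℝ P B).prod (ContinuousLinearMap.snd ℝ P B + L)
  let e : (P × B) ≃L[ℝ] (P × B) := ContinuousLinearEquiv.equivOfInverse A A'
    (by rintro ⟨a, v⟩; simp [A, A', hLe a v, hLe a (v - _)])
    (by rintro ⟨a, v⟩; simp [A, A', hLe a v, hLe a (v + _)])
  have hTe : HasFDerivAt T (e : (P × B) →L[ℝ] (P × B)) (p0, u0) := by
    have : (e : (P × B) →L[ℝ] (P × B)) = A := rfl
    rw [this]
    exact hasFDerivAt_fst.prodMk (hasFDerivAt_snd.sub hL)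
  let H := hT.contDiffAt.toOpenPartialHomeomorph T hTe htop
  have hsrc : (p0, u0) ∈ H.source := hT.contDiffAt.mem_toOpenPartialHomeomorph_source hTe htop
  have hHT : ∀ z, H z = T z := fun z => rfl
  let V : Set (P × B) := fderiv ℝ T ⁻¹' range ((↑) : ((P × B) ≃L[ℝ] (P × B)) → _)
  have hV : IsOpen V := ContinuousLinearEquiv.isOpen.preimage (hT.continuous_fderiv htop)
  have hVm : (p0, u0) ∈ V := ⟨e, hTe.fderiv.symm⟩
  have hT0 : T (p0, u0) = (p0, 0) := by simp [T, h0]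
  let j : P → P × B := fun p => (p, 0)
  have hj : Continuous j := by fun_prop
  refine ⟨j ⁻¹' (H.target ∩ H.symm ⁻¹' V), H.source, fun p => (H.symm (j p)).2, ?_, ?_,
    H.open_source, hsrc, ?_, ?_⟩
  · exact (H.symm.isOpen_inter_preimage hV).preimage hj
  · have : j p0 = H (p0, u0) := hT0.symm
    refine ⟨?_, ?_⟩
    · rw [this]; exact H.map_source hsrc
    · rw [this, mem_preimage, H.left_inv hsrc]; exact hVm
  · intro p hp
    obtain ⟨e', he'⟩ := hp.2
    have h1 : ContDiffAt ℝ (⊤ : ℕ∞) H.symm (j p) := by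
      refine H.contDiffAt_symm (f₀' := e') hp.1 ?_ hT.contDiffAt
      rw [he']
      exact (hT.differentiable htop _).hasFDerivAt
    have h2 : ContDiffAt ℝ (⊤ : ℕ∞) j p := contDiffAt_id.prodMk contDiffAt_const
    exact (contDiffAt_snd.comp p (h1.comp p h2)).contDiffWithinAt
  · intro p u hpu hu
    have : j p = H (p, u) := by
      rw [hHT]; simp only [T, j, ← hu, sub_self]
    simp only [this, H.left_inv hpu]

noncomputable def iotaop {J X : Type} [NormedAddCommGroup J] [NormedSpace ℝ J]
    [NormedAddCommGroup X] [NormedSpace ℝ X] :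
    ((J × X) × C(Icc (0:ℝ) 1, J)) →L[ℝ] C(Icc (0:ℝ) 1, J × X × X) :=
  LinearMap.mkContinuous
    { toFun := fun z => ⟨fun t => (z.2 t, (t : ℝ) • z.1.2, z.1.2), by fun_prop⟩
      map_add' := by intro u v; ext t <;> simp
      map_smul' := by
        intro c v
        refine ContinuousMap.ext fun t => ?_
        simp [smul_comm (t : ℝ) c] } 1
    (by
      intro z
      rw [ContinuousMap.norm_le _ (by positivity), one_mul]
      intro t
      have h1 : ‖z.2 t‖ ≤ ‖z‖ := (z.2.norm_coe_le_norm t).trans (norm_snd_le z)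
      have h2 : ‖z.1.2‖ ≤ ‖z‖ := (norm_snd_le z.1).trans (norm_fst_le z)
      have h3 : ‖(t : ℝ) • z.1.2‖ ≤ ‖z‖ := by
        rw [norm_smul, Real.norm_of_nonneg t.2.1]
        exact (mul_le_of_le_one_left (norm_nonneg _) t.2.2).trans h2
      exact norm_prod_le_iff.2 ⟨h1, norm_prod_le_iff.2 ⟨h3, h2⟩⟩)

lemma ode_key {J X : Type} [NormedAddCommGroup J] [NormedSpace ℝ J] [CompleteSpace J]
    [NormedAddCommGroup X] [NormedSpace ℝ X] [CompleteSpace X]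
    (g : J × X × X → J) (hg : ContDiff ℝ (⊤ : ℕ∞) g) (hg0 : ∀ l y, g (l, y, 0) = 0) (l0 : J) :
    ∃ (U₀ : Set J) (V₀ : Set X) (G : J × X → J), IsOpen U₀ ∧ l0 ∈ U₀ ∧ IsOpen V₀ ∧
      (0 : X) ∈ V₀ ∧ ContDiffOn ℝ (⊤ : ℕ∞) G (U₀ ×ˢ V₀) ∧
      ∀ (w : X → J) (w' : X → X →L[ℝ] J),
        (∀ᶠ y in 𝓝 (0 : X), HasFDerivAt w (w' y) y ∧ ∀ x, w' y x = g (w y, y, x)) →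
        w 0 ∈ U₀ → ∀ᶠ x in 𝓝 (0 : X), w x = G (w 0, x) := by
  let K : J →L[ℝ] C(Icc (0:ℝ) 1, J) := LinearMap.mkContinuous
    { toFun := fun a => ContinuousMap.const _ a
      map_add' := by intro u v; ext t; simp
      map_smul' := by intro c v; ext t; simp } 1
    (by
      intro a
      rw [ContinuousMap.norm_le _ (by positivity), one_mul]
      intro t; exact le_rfl)
  have hK : ∀ a t, K a t = a := fun a t => rfl
  let S : (J × X) × C(Icc (0:ℝ) 1, J) → C(Icc (0:ℝ) 1, J) :=
    fun z => K z.1.1 + intop (nem g hg.continuous (iotaop z))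
  have hS : ContDiff ℝ (⊤ : ℕ∞) S := by
    refine ContDiff.add (K.contDiff.comp (contDiff_fst.comp contDiff_fst)) ?_
    exact intop.contDiff.comp ((nem_contDiff g hg).comp iotaop.contDiff)
  have h0 : ∀ u, S ((l0, 0), u) = K l0 := by
    intro u
    have : nem g hg.continuous (iotaop ((l0, (0 : X)), u)) = 0 := by
      ext t
      show g (u t, (t : ℝ) • (0 : X), 0) = 0
      exact hg0 _ _
    simp only [S, this, map_zero, add_zero]
  obtain ⟨O, O', G, hO, hpO, hO', hpO', hG, huniq⟩ := implicit_aux S hS (l0, 0) (K l0) h0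
  obtain ⟨A, B, hA, hlA, hB, h0B, hAB⟩ := mem_nhds_prod_iff'.1 (hO.mem_nhds hpO)
  let c : J → (J × X) × C(Icc (0:ℝ) 1, J) := fun a => ((a, 0), K a)
  have hc : Continuous c := by fun_prop
  refine ⟨A ∩ c ⁻¹' O', B, fun z => G z 1, hA.inter (hO'.preimage hc), ⟨hlA, hpO'⟩, hB, h0B,
    ?_, ?_⟩
  · have h1 : ContDiffOn ℝ (⊤ : ℕ∞) G ((A ∩ c ⁻¹' O') ×ˢ B) :=
      hG.mono fun z hz => hAB ⟨hz.1.1, hz.2⟩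
    exact (ContinuousMap.evalCLM ℝ (1 : Icc (0:ℝ) 1)).contDiff.comp_contDiffOn h1
  · intro w w' hw hw0
    obtain ⟨δ, hδ, hball⟩ := Metric.isOpen_iff.1 hO' _ hw0.2
    have hwc : ContinuousAt w 0 := hw.self_of_nhds.1.continuousAt
    obtain ⟨ρ, hρ, hρw⟩ := Metric.eventually_nhds_iff_ball.1
      (hw.and (hwc.eventually (Metric.ball_mem_nhds (w 0) (half_pos hδ))))
    filter_upwards [Metric.ball_mem_nhds (0 : X) (lt_min hρ hδ)] with x hx
    rw [mem_ball_zero_iff, lt_min_iff] at hx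
    have htx : ∀ t : ℝ, t ∈ Icc (0:ℝ) 1 → t • x ∈ Metric.ball (0 : X) ρ := by
      intro t ht
      rw [mem_ball_zero_iff, norm_smul, Real.norm_of_nonneg ht.1]
      exact (mul_le_of_le_one_left (norm_nonneg _) ht.2).trans_lt hx.1
    let γ : C(Icc (0:ℝ) 1, J) := ⟨fun t => w ((t : ℝ) • x), by
      rw [continuous_iff_continuousAt]
      intro t
      have h1 : ContinuousAt w ((t : ℝ) • x) := (hρw _ (htx t t.2)).1.1.continuousAt
      have h2 : ContinuousAt (fun t : Icc (0:ℝ) 1 => (t : ℝ) • x) t := by fun_prop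
      exact ContinuousAt.comp (f := fun t : Icc (0:ℝ) 1 => (t : ℝ) • x) h1 h2⟩
    have hγ1 : γ 1 = w x := by simp [γ]
    have hmem : ((w 0, x), γ) ∈ O' := by
      apply hball
      rw [Metric.mem_ball, Prod.dist_eq, max_lt_iff, Prod.dist_eq, max_lt_iff]
      refine ⟨⟨by simpa [c] using hδ, by simpa [c] using hx.2⟩, ?_⟩
      refine lt_of_le_of_lt ?_ (half_lt_self hδ)
      rw [ContinuousMap.dist_le (half_pos hδ).le]
      intro t
      exact (hρw _ (htx t t.2)).2.le
    have heq : γ = S ((w 0, x), γ) := by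
      ext t
      have hder : ∀ s ∈ uIcc (0:ℝ) t, HasDerivAt (fun s : ℝ => w (s • x))
          (nem g hg.continuous (iotaop ((w 0, x), γ)) (projIcc 0 1 zero_le_one s)) s := by
        intro s hs
        rw [uIcc_of_le t.2.1] at hs
        have hs' : s ∈ Icc (0:ℝ) 1 := ⟨hs.1, hs.2.trans t.2.2⟩
        rw [projIcc_of_mem _ hs']
        have h1 := (hρw _ (htx s hs')).1
        have h2 : HasDerivAt (fun s : ℝ => s • x) x s := by
          simpa using (hasDerivAt_id s).smul_const x
        have h3 := h1.1.comp_hasDerivAt s h2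
        rw [h1.2 x] at h3
        exact h3
      have hcont : Continuous fun s : ℝ =>
          nem g hg.continuous (iotaop ((w 0, x), γ)) (projIcc 0 1 zero_le_one s) :=
        (ContinuousMap.continuous _).comp continuous_projIcc
      have := intervalIntegral.integral_eq_sub_of_hasDerivAt hder
        (hcont.intervalIntegrable _ _)
      show w ((t : ℝ) • x) = K (w 0) t + intop _ t
      rw [intop_apply, this, hK]
      simp
    have := huniq _ _ hmem heq
    rw [← hγ1]
    exact congrArg (fun v : C(Icc (0:ℝ) 1, J) => v 1) this

lemma pd_congr {q : ℕ} (i : Fin q) {W : Set (Fin q → ℝ)} (hW : IsOpen W)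
    {u v : (Fin q → ℝ) → ℝ} (h : EqOn u v W) : EqOn (pd q i u) (pd q i v) W := by
  intro x hx
  simp only [pd]
  rw [(h.eventuallyEq_of_mem (hW.mem_nhds hx)).fderiv_eq]

lemma pd_smooth {q : ℕ} (i : Fin q) {W : Set (Fin q → ℝ)} (hW : IsOpen W)
    {u : (Fin q → ℝ) → ℝ} (h : ContDiffOn ℝ (⊤ : ℕ∞) u W) :
    ContDiffOn ℝ (⊤ : ℕ∞) (pd q i u) W :=
  (h.fderiv_of_isOpen hW (by simp)).clm_apply contDiffOn_const

lemma pd_comm {q : ℕ} (i j : Fin q) {W : Set (Fin q → ℝ)} (hW : IsOpen W)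
    {u : (Fin q → ℝ) → ℝ} (h : ContDiffOn ℝ (⊤ : ℕ∞) u W) :
    EqOn (pd q i (pd q j u)) (pd q j (pd q i u)) W := by
  intro x hx
  have hs : ContDiffAt ℝ (⊤ : ℕ∞) u x := h.contDiffAt (hW.mem_nhds hx)
  have hsym : IsSymmSndFDerivAt ℝ u x := hs.isSymmSndFDerivAt (by
    simp only [minSmoothness_of_isRCLikeNormedField]; exact WithTop.coe_le_coe.2 (le_top : (2 : ℕ∞) ≤ ⊤))
  have hd : DifferentiableAt ℝ (fderiv ℝ u) x :=
    (hs.fderiv_right (m := 1) (WithTop.coe_le_coe.2 (le_top : (2 : ℕ∞) ≤ ⊤))).differentiableAt one_ne_zero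
  have key : ∀ a b : Fin q, pd q a (pd q b u) x
      = fderiv ℝ (fderiv ℝ u) x (Pi.single a 1) (Pi.single b 1) := by
    intro a b
    show fderiv ℝ (fun y => fderiv ℝ u y (Pi.single b 1)) x (Pi.single a 1) = _
    rw [fderiv_clm_apply hd (differentiableAt_const _)]
    simp
  rw [key, key, hsym.eq]

lemma pdit_congr {q : ℕ} (i : Fin q) {W : Set (Fin q → ℝ)} (hW : IsOpen W) (n : ℕ) :
    ∀ {u v : (Fin q → ℝ) → ℝ}, EqOn u v W → EqOn ((pd q i)^[n] u) ((pd q i)^[n] v) W := by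
  induction n with
  | zero => intro u v h; exact h
  | succ n ih => intro u v h; exact ih (pd_congr i hW h)

lemma pdit_smooth {q : ℕ} (i : Fin q) {W : Set (Fin q → ℝ)} (hW : IsOpen W) (n : ℕ) :
    ∀ {u : (Fin q → ℝ) → ℝ}, ContDiffOn ℝ (⊤ : ℕ∞) u W →
      ContDiffOn ℝ (⊤ : ℕ∞) ((pd q i)^[n] u) W := by
  induction n with
  | zero => intro u h; exact h
  | succ n ih => intro u h; exact ih (pd_smooth i hW h)

lemma pdit_comm {q : ℕ} (i j : Fin q) {W : Set (Fin q → ℝ)} (hW : IsOpen W) (n : ℕ) :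
    ∀ {u : (Fin q → ℝ) → ℝ}, ContDiffOn ℝ (⊤ : ℕ∞) u W →
      EqOn (pd q i ((pd q j)^[n] u)) ((pd q j)^[n] (pd q i u)) W := by
  induction n with
  | zero => intro u h; exact fun x _ => rfl
  | succ n ih =>
    intro u h
    exact (ih (pd_smooth j hW h)).trans (pdit_congr j hW n (pd_comm i j hW h))

noncomputable def pdl (q : ℕ) (l : List (Fin q)) (β : Fin q → ℕ) (u : (Fin q → ℝ) → ℝ) :
    (Fin q → ℝ) → ℝ :=
  (l.foldr (fun i F => (pd q i)^[β i] ∘ F) id) u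

lemma pdl_cons {q : ℕ} (a : Fin q) (l : List (Fin q)) (β : Fin q → ℕ) (u : (Fin q → ℝ) → ℝ) :
    pdl q (a :: l) β u = (pd q a)^[β a] (pdl q l β u) := rfl

lemma pdl_smooth {q : ℕ} {W : Set (Fin q → ℝ)} (hW : IsOpen W) (l : List (Fin q))
    (β : Fin q → ℕ) {u : (Fin q → ℝ) → ℝ} (h : ContDiffOn ℝ (⊤ : ℕ∞) u W) :
    ContDiffOn ℝ (⊤ : ℕ∞) (pdl q l β u) W := by
  induction l with
  | nil => exact h
  | cons a l ih => rw [pdl_cons]; exact pdit_smooth a hW _ ih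

lemma pdl_notMem {q : ℕ} (l : List (Fin q)) (i : Fin q) (hi : i ∉ l)
    (β : Fin q → ℕ) (u : (Fin q → ℝ) → ℝ) :
    pdl q l (β + Pi.single i 1) u = pdl q l β u := by
  induction l with
  | nil => rfl
  | cons a l ih =>
    rw [List.mem_cons, not_or] at hi
    rw [pdl_cons, pdl_cons, ih hi.2]
    simp [Pi.single_eq_of_ne (Ne.symm hi.1)]

lemma pdl_pd {q : ℕ} {W : Set (Fin q → ℝ)} (hW : IsOpen W) (l : List (Fin q)) (hl : l.Nodup)
    (i : Fin q) (hi : i ∈ l)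
    (β : Fin q → ℕ) {u : (Fin q → ℝ) → ℝ} (h : ContDiffOn ℝ (⊤ : ℕ∞) u W) :
    EqOn (pd q i (pdl q l β u)) (pdl q l (β + Pi.single i 1) u) W := by
  induction l with
  | nil => simp at hi
  | cons a l ih =>
    rw [List.nodup_cons] at hl
    rw [pdl_cons, pdl_cons]
    by_cases hia : i = a
    · subst hia
      rw [pdl_notMem l i hl.1]
      intro x _
      simp [Function.iterate_succ_apply']
    · have hil : i ∈ l := by simpa [hia] using hi
      have : (β + Pi.single i 1 : Fin q → ℕ) a = β a := by simp [Pi.single_eq_of_ne (Ne.symm hia)]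
      rw [this]
      exact (pdit_comm i a hW _ (pdl_smooth hW l β h)).trans
        (pdit_congr a hW _ (ih hl.2 hil))

lemma pdm_smooth {q : ℕ} {W : Set (Fin q → ℝ)} (hW : IsOpen W)
    (β : Fin q → ℕ) {u : (Fin q → ℝ) → ℝ} (h : ContDiffOn ℝ (⊤ : ℕ∞) u W) :
    ContDiffOn ℝ (⊤ : ℕ∞) (pdm q β u) W := pdl_smooth hW _ β h

lemma pdm_pd {q : ℕ} {W : Set (Fin q → ℝ)} (hW : IsOpen W) (i : Fin q)
    (β : Fin q → ℕ) {u : (Fin q → ℝ) → ℝ} (h : ContDiffOn ℝ (⊤ : ℕ∞) u W) :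
    EqOn (pd q i (pdm q β u)) (pdm q (β + Pi.single i 1) u) W :=
  pdl_pd hW _ (List.nodup_finRange q) i (List.mem_finRange i) β h

lemma pdm_zero {q : ℕ} (u : (Fin q → ℝ) → ℝ) : pdm q 0 u = u := by
  have : ∀ l : List (Fin q), pdl q l 0 u = u := by
    intro l
    induction l with
    | nil => rfl
    | cons a l ih => rw [pdl_cons, ih]; rfl
  exact this _

lemma sum_add_single {q : ℕ} (β : Fin q → ℕ) (i : Fin q) :
    ∑ j, (β + Pi.single i 1 : Fin q → ℕ) j = ∑ j, β j + 1 := by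
  simp [Finset.sum_add_distrib]

lemma cutoff_smooth {E : Type} [NormedAddCommGroup E] [NormedSpace ℝ E] {U : Set E}
    (hU : IsOpen U) (χ c : E → ℝ) (hχ : ContDiff ℝ (⊤ : ℕ∞) χ) (hs : tsupport χ ⊆ U)
    (hc : ContDiffOn ℝ (⊤ : ℕ∞) c U) : ContDiff ℝ (⊤ : ℕ∞) (fun z => χ z * c z) := by
  rw [contDiff_iff_contDiffAt]
  intro z
  by_cases hz : z ∈ U
  · exact hχ.contDiffAt.mul (hc.contDiffAt (hU.mem_nhds hz))
  · have h0 : χ =ᶠ[𝓝 z] 0 := notMem_tsupport_iff_eventuallyEq.1 fun h => hz (hs h)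
    have : (fun z => χ z * c z) =ᶠ[𝓝 z] fun _ => 0 := by
      filter_upwards [h0] with y hy
      simp [hy]
    exact contDiffAt_const.congr_of_eventuallyEq this

lemma jet_fderiv {q m k : ℕ} {f : (Fin q → ℝ) → Fin m → ℝ} {W : Set (Fin q → ℝ)}
    (hW : IsOpen W) (hf : ContDiffOn ℝ (⊤ : ℕ∞) f W) {y : Fin q → ℝ} (hy : y ∈ W) :
    HasFDerivAt (jetAt q m k f) (fderiv ℝ (jetAt q m k f) y) y ∧
    ∀ x β j, fderiv ℝ (jetAt q m k f) y x β j =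
      ∑ i, x i * pdm q (β.1 + Pi.single i 1) (fun y => f y j) y := by
  have hfj : ∀ j, ContDiffOn ℝ (⊤ : ℕ∞) (fun y => f y j) W := fun j => contDiffOn_pi.1 hf j
  have hw : ContDiffOn ℝ (⊤ : ℕ∞) (jetAt q m k f) W :=
    contDiffOn_pi.2 fun β => contDiffOn_pi.2 fun j => pdm_smooth hW β.1 (hfj j)
  have hd : HasFDerivAt (jetAt q m k f) (fderiv ℝ (jetAt q m k f) y) y :=
    ((hw.contDiffAt (hW.mem_nhds hy)).differentiableAt (by simp)).hasFDerivAt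
  refine ⟨hd, fun x β j => ?_⟩
  have h1 : HasFDerivAt (fun y => jetAt q m k f y β j)
      ((ContinuousLinearMap.proj j).comp ((ContinuousLinearMap.proj β).comp
        (fderiv ℝ (jetAt q m k f) y))) y :=
    hasFDerivAt_pi'.1 (hasFDerivAt_pi'.1 hd β) j
  have h2 : fderiv ℝ (jetAt q m k f) y x β j =
      fderiv ℝ (pdm q β.1 (fun y => f y j)) y x := by
    have : fderiv ℝ (pdm q β.1 (fun y => f y j)) y = _ := h1.fderiv
    rw [this]; rfl
  rw [h2]
  have hx : x = ∑ i, x i • (Pi.single i 1 : Fin q → ℝ) := by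
    ext l; simp [Finset.sum_apply, Pi.single_apply]
  conv_lhs => rw [hx]
  rw [map_sum]
  refine Finset.sum_congr rfl fun i _ => ?_
  rw [map_smul, smul_eq_mul, ← pdm_pd hW i β.1 (hfj j) hy]
  rfl

/-- Solutions of a smooth complete system of order `k+1` are locally
reproduced, on a fixed neighborhood of `0`, by a single smooth function of their `k`-jet at
`0` and the base point. -/
theorem statement19 (q m k : ℕ) (hq : 0 < q) (hm : 0 < m) (hk : 0 < k)
    (U : Set (JetSp q m k × (Fin q → ℝ))) (hU : IsOpen U)
    (r : (Fin q → ℕ) → Fin m → JetSp q m k × (Fin q → ℝ) → ℝ)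
    (hr : ∀ α, (∑ i, α i) = k + 1 → ∀ j, ContDiffOn ℝ (⊤ : ℕ∞) (r α j) U)
    (lam0 : JetSp q m k) (hlam0 : (lam0, (0 : Fin q → ℝ)) ∈ U) :
    ∃ (U₀ : Set (JetSp q m k)) (V₀ : Set (Fin q → ℝ))
      (F : JetSp q m k × (Fin q → ℝ) → Fin m → ℝ),
      IsOpen U₀ ∧ lam0 ∈ U₀ ∧ IsOpen V₀ ∧ (0 : Fin q → ℝ) ∈ V₀ ∧
      ContDiffOn ℝ (⊤ : ℕ∞) F (U₀ ×ˢ V₀) ∧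
      ∀ (f : (Fin q → ℝ) → Fin m → ℝ) (W : Set (Fin q → ℝ)), IsOpen W →
        (0 : Fin q → ℝ) ∈ W → ContDiffOn ℝ (⊤ : ℕ∞) f W →
        (∀ x ∈ W, (jetAt q m k f x, x) ∈ U ∧
          ∀ α, (∑ i, α i) = k + 1 → ∀ j,
            pdm q α (fun y => f y j) x = r α j (jetAt q m k f x, x)) →
        jetAt q m k f 0 ∈ U₀ →
        ∀ᶠ x in 𝓝 (0 : Fin q → ℝ), f x = F (jetAt q m k f 0, x) := by
  classical
  let J := JetSp q m k
  let X := Fin q → ℝ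
  obtain ⟨ε, hε, hεU⟩ := Metric.isOpen_iff.1 hU _ hlam0
  let χ : ContDiffBump ((lam0, 0) : J × X) :=
    ⟨ε / 4, ε / 2, by positivity, by linarith⟩
  have hχs : tsupport χ ⊆ U := by
    rw [χ.tsupport_eq]
    exact (Metric.closedBall_subset_ball (half_lt_self hε)).trans hεU
  have hχ : ContDiff ℝ (⊤ : ℕ∞) χ := χ.contDiff
  let c : {β : Fin q → ℕ // ∑ i, β i ≤ k} → Fin m → Fin q → J × X → ℝ := fun β j i z =>
    if h : ∑ l, (β.1 + Pi.single i 1 : Fin q → ℕ) l ≤ k then z.1 ⟨β.1 + Pi.single i 1, h⟩ j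
    else r (β.1 + Pi.single i 1) j z
  have hc : ∀ β j i, ContDiffOn ℝ (⊤ : ℕ∞) (c β j i) U := by
    intro β j i
    by_cases h : ∑ l, (β.1 + Pi.single i 1 : Fin q → ℕ) l ≤ k
    · simp only [c, dif_pos h]
      exact (contDiff_pi.1 (contDiff_pi.1 contDiff_fst _) _).contDiffOn
    · simp only [c, dif_neg h]
      refine hr _ ?_ j
      have h1 := sum_add_single β.1 i
      have h2 := β.2
      omega
  let g : J × X × X → J := fun z β j => ∑ i, z.2.2 i * (χ (z.1, z.2.1) * c β j i (z.1, z.2.1))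
  have hg : ContDiff ℝ (⊤ : ℕ∞) g := by
    refine contDiff_pi.2 fun β => contDiff_pi.2 fun j => ContDiff.sum fun i _ => ?_
    have h1 := cutoff_smooth hU χ (c β j i) hχ hχs (hc β j i)
    have h2 : ContDiff ℝ (⊤ : ℕ∞) (fun z : J × X × X => (z.1, z.2.1)) :=
      contDiff_fst.prodMk (contDiff_fst.comp contDiff_snd)
    have h3 : ContDiff ℝ (⊤ : ℕ∞) (fun z : J × X × X => z.2.2 i) :=
      contDiff_pi.1 (contDiff_snd.comp contDiff_snd) i
    exact h3.mul (h1.comp h2)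
  have hg0 : ∀ l y, g (l, y, 0) = 0 := by
    intro l y
    funext β j
    exact Finset.sum_eq_zero fun i _ => zero_mul _
  obtain ⟨U₀, V₀, G, hU₀, hl, hV₀, h0, hG, hmain⟩ := ode_key g hg hg0 lam0
  let N : Set (J × X) := Metric.ball (lam0, 0) (ε / 4)
  have hN : IsOpen N := Metric.isOpen_ball
  let ι : J → J × X := fun a => (a, 0)
  have hι : Continuous ι := by fun_prop
  let z0 : {β : Fin q → ℕ // ∑ i, β i ≤ k} := ⟨0, by simp⟩
  refine ⟨U₀ ∩ ι ⁻¹' N, V₀, fun z => G z z0, hU₀.inter (hN.preimage hι),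
    ⟨hl, Metric.mem_ball_self (by positivity)⟩, hV₀, h0, ?_, ?_⟩
  · exact contDiffOn_pi.1 (hG.mono fun z hz => ⟨hz.1.1, hz.2⟩) z0
  · intro f W hW h0W hf hsys hjet
    have hev : ∀ᶠ y in 𝓝 (0 : X), HasFDerivAt (jetAt q m k f) (fderiv ℝ (jetAt q m k f) y) y ∧
        ∀ x, fderiv ℝ (jetAt q m k f) y x = g (jetAt q m k f y, y, x) := by
      have hcont : ContinuousAt (fun y => (jetAt q m k f y, y)) 0 :=
        (jet_fderiv hW hf h0W).1.continuousAt.prodMk continuousAt_id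
      filter_upwards [hW.mem_nhds h0W, hcont.eventually (hN.mem_nhds hjet.2)] with y hy hyN
      obtain ⟨hd, hd'⟩ := jet_fderiv (k := k) hW hf hy
      refine ⟨hd, fun x => ?_⟩
      funext β j
      rw [hd']
      have hχ1 : χ (jetAt q m k f y, y) = 1 :=
        χ.one_of_mem_closedBall (Metric.ball_subset_closedBall hyN)
      refine Finset.sum_congr rfl fun i _ => ?_
      show _ = x i * (χ (jetAt q m k f y, y) * c β j i (jetAt q m k f y, y))
      rw [hχ1, one_mul]
      congr 1
      by_cases h : ∑ l, (β.1 + Pi.single i 1 : Fin q → ℕ) l ≤ k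
      · simp only [c, dif_pos h]
        rfl
      · simp only [c, dif_neg h]
        refine (hsys y hy).2 _ ?_ j
        have h1 := sum_add_single β.1 i
        have h2 := β.2
        omega
    filter_upwards [hmain _ _ hev hjet.1] with x hx
    have := congrFun hx z0
    rw [← this]
    funext j
    show f x j = pdm q 0 (fun y => f y j) x
    rw [pdm_zero]
end
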